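/- arXiv:1706.07393 — 2 statements merged into one kernel-verified Lean document; each statement's English description precedes it below -/
import Mathlib

section
/- Gaussian heat-kernel identity on interlacing roots: let x_1^k,...,x_k^k be the roots of a degree-k real polynomial f with distinct roots, and x_1^{k-1},...,x_{k-1}^{k-1} the roots of f'. Then for any reals ζ_1,...,ζ_k, ∫_{ℝ^{k-1}} exp(−∑_{a=1}^k ∑_{b=1}^{k-1} (ζ_a − ξ_b)²/(x_a^k − x_b^{k-1})²) dξ_1⋯dξ_{k-1} = Z · exp(−2 ∑_{1≤a<b≤k} (ζ_a − ζ_b)²/(x_a^k − x_b^k)²), for some constant Z > 0 independent of ζ. -/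
open Finset Polynomial MeasureTheory

/-- First and second derivatives of a product of linear factors away from its roots. -/
theorem eval_derivatives_prod_X_sub_C {ι : Type*} (s : Finset ι) (x : ι → ℝ) (y : ℝ)
    (h : ∀ a ∈ s, y ≠ x a) :
    (derivative (∏ a ∈ s, (X - C (x a)))).eval y
        = (∏ a ∈ s, (y - x a)) * ∑ a ∈ s, 1 / (y - x a) ∧
      (derivative (derivative (∏ a ∈ s, (X - C (x a))))).eval y
        = (∏ a ∈ s, (y - x a)) *
          ((∑ a ∈ s, 1 / (y - x a)) ^ 2 - ∑ a ∈ s, 1 / (y - x a) ^ 2) := by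
  classical
  induction s using Finset.induction_on with
  | empty => simp
  | insert a s ha ih =>
    obtain ⟨h1, h2⟩ := ih fun c hc => h c (mem_insert_of_mem hc)
    have hne : y - x a ≠ 0 := sub_ne_zero.2 (h a (mem_insert_self a s))
    simp only [prod_insert ha, sum_insert ha, derivative_mul, derivative_sub, derivative_X,
      derivative_C, sub_zero, one_mul, derivative_add, eval_add, eval_mul, eval_sub, eval_X,
      eval_C, h1, h2, eval_prod]
    constructor
    · field_simp
    · field_simp
      ring

/-- A weighted sum of squares, completed to a square around its weighted mean. -/
theorem weighted_sum_sq_sub {ι : Type*} (s : Finset ι) (w z : ι → ℝ) (t : ℝ)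
    (hw : ∑ a ∈ s, w a ≠ 0) :
    ∑ a ∈ s, w a * (z a - t) ^ 2
      = (∑ a ∈ s, w a) * (t - (∑ a ∈ s, w a * z a) / ∑ a ∈ s, w a) ^ 2
        + ∑ a ∈ s, ∑ c ∈ s, w a * w c / (2 * ∑ a ∈ s, w a) * (z a - z c) ^ 2 := by
  have h1 : ∑ a ∈ s, w a * (z a - t) ^ 2
      = ∑ a ∈ s, w a * z a ^ 2 - 2 * t * ∑ a ∈ s, w a * z a + t ^ 2 * ∑ a ∈ s, w a := by
    simp only [mul_sum, ← sum_sub_distrib, ← sum_add_distrib]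
    exact sum_congr rfl fun a _ => by ring
  have h2 (W : ℝ) : ∑ a ∈ s, ∑ c ∈ s, w a * w c / (2 * W) * (z a - z c) ^ 2
      = ((∑ a ∈ s, w a * z a ^ 2) * (∑ c ∈ s, w c)
          - 2 * ((∑ a ∈ s, w a * z a) * ∑ c ∈ s, w c * z c)
          + (∑ a ∈ s, w a) * ∑ c ∈ s, w c * z c ^ 2) / (2 * W) := by
    rw [sum_mul_sum, sum_mul_sum, sum_mul_sum]
    simp only [mul_sum, ← sum_sub_distrib, ← sum_add_distrib, sum_div]
    exact sum_congr rfl fun a _ => sum_congr rfl fun c _ => by ring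
  rw [h1, h2]
  field_simp
  ring

theorem integral_exp_neg_weighted_sum_sq {ι : Type*} (s : Finset ι) (w z : ι → ℝ)
    (hw : ∑ a ∈ s, w a ≠ 0) :
    ∫ t : ℝ, Real.exp (-∑ a ∈ s, w a * (z a - t) ^ 2)
      = √(Real.pi / ∑ a ∈ s, w a)
        * Real.exp (-∑ a ∈ s, ∑ c ∈ s, w a * w c / (2 * ∑ a ∈ s, w a) * (z a - z c) ^ 2) := by
  simp only [weighted_sum_sq_sub s w z _ hw, neg_add, Real.exp_add]
  rw [integral_mul_const, ← integral_gaussian]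
  congr 1
  rw [← integral_sub_right_eq_self (fun t : ℝ => Real.exp (-(∑ a ∈ s, w a) * t ^ 2))
    ((∑ a ∈ s, w a * z a) / ∑ a ∈ s, w a)]
  simp only [neg_mul]

theorem sum_sum_filter_lt_of_symm {ι : Type*} [Fintype ι] [LinearOrder ι] (T : ι → ι → ℝ)
    (hT : ∀ a c, T a c = T c a) (h0 : ∀ a, T a a = 0) :
    2 * ∑ a, ∑ c ∈ univ.filter (fun c => a < c), T a c = ∑ a, ∑ c, T a c := by
  have h1 : ∑ a, ∑ c, T a c
      = ∑ a, ∑ c, (if a < c then T a c else 0) + ∑ a, ∑ c, (if c < a then T a c else 0) := by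
    simp only [← sum_add_distrib]
    refine sum_congr rfl fun a _ => sum_congr rfl fun c _ => ?_
    rcases lt_trichotomy a c with h | h | h
    · simp [h, h.not_gt]
    · simp [h, h0]
    · simp [h, h.not_gt]
  have h2 : ∑ a, ∑ c, (if c < a then T a c else 0) = ∑ a, ∑ c, (if a < c then T a c else 0) := by
    rw [sum_comm]
    exact sum_congr rfl fun a _ => sum_congr rfl fun c _ => by rw [hT]
  rw [h1, h2]
  simp only [sum_filter]
  ring

/-- Residue identity linking the roots of a polynomial and its critical points. -/
theorem sum_inv_sq_mul_inv_sq_div_critical_points {k : ℕ} {x : Fin k → ℝ}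
    (hx : Function.Injective x) {y : Fin (k - 1) → ℝ}
    (hy : derivative (∏ a, (X - C (x a))) = C (k : ℝ) * ∏ b, (X - C (y b)))
    (hxy : ∀ a b, x a ≠ y b) {a c : Fin k} (hac : a ≠ c) :
    ∑ b, 1 / (x a - y b) ^ 2 * (1 / (x c - y b) ^ 2) / ∑ d, 1 / (x d - y b) ^ 2
      = 2 / (x a - x c) ^ 2 := by
  have hk : (k : ℝ) ≠ 0 := by
    have := a.pos
    positivity
  set g : ℝ[X] := ∏ d ∈ (univ.erase a).erase c, (X - C (x d)) with hg
  have hc : c ∈ univ.erase a := mem_erase.2 ⟨hac.symm, mem_univ c⟩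
  have hfac : ∏ d, (X - C (x d)) = (X - C (x a)) * ((X - C (x c)) * g) := by
    rw [hg, mul_prod_erase _ (fun d => X - C (x d)) hc,
      mul_prod_erase _ (fun d => X - C (x d)) (mem_univ a)]
  have hdeg : g.degree < (univ : Finset (Fin (k - 1))).card := by
    rw [hg, degree_prod]
    have h1 := card_pos.2 ⟨c, hc⟩
    simp only [degree_X_sub_C, sum_const, card_erase_of_mem hc, card_erase_of_mem (mem_univ a),
      card_univ, Fintype.card_fin, nsmul_eq_mul, mul_one] at h1 ⊢
    exact_mod_cast (by omega : k - 1 - 1 < k - 1)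
  have hW (b) : 0 < ∑ d, 1 / (x d - y b) ^ 2 :=
    sum_pos (fun d _ => by have := sub_ne_zero.2 (hxy d b); positivity) ⟨a, mem_univ a⟩
  have hP (b) : ∏ d, (y b - x d) ≠ 0 :=
    prod_ne_zero_iff.2 fun d _ => sub_ne_zero.2 (hxy d b).symm
  have hsecond (b) : k * (derivative (Lagrange.nodal univ y)).eval (y b)
      = -((∏ d, (y b - x d)) * ∑ d, 1 / (x d - y b) ^ 2) := by
    obtain ⟨h1, h2⟩ := eval_derivatives_prod_X_sub_C univ x (y b) fun d _ => (hxy d b).symm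
    have h0 : (derivative (∏ d, (X - C (x d)))).eval (y b) = 0 := by
      rw [hy, eval_mul, eval_prod, prod_eq_zero (mem_univ b) (by simp), mul_zero]
    have h3 : ∑ d, 1 / (y b - x d) = 0 := by
      simpa [hP b] using h1.symm.trans h0
    rw [hy, h3, derivative_C_mul, eval_C_mul] at h2
    rw [Lagrange.nodal, h2, sum_congr rfl fun d _ => by rw [sub_sq_comm (y b) (x d)]]
    ring
  have hder (b) : (derivative (Lagrange.nodal univ y)).eval (y b) ≠ 0 := by
    intro h
    have := hsecond b
    rw [h, mul_zero, eq_comm, neg_eq_zero] at this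
    exact mul_ne_zero (hP b) (hW b).ne' this
  have hinj : Set.InjOn y (univ : Finset (Fin (k - 1))) := by
    intro b _ b' _ hbb
    by_contra hne
    apply hder b
    rw [Lagrange.eval_nodal_derivative_eval_node_eq (mem_univ b), Lagrange.eval_nodal]
    exact prod_eq_zero (mem_erase.2 ⟨Ne.symm hne, mem_univ b'⟩) (sub_eq_zero.2 hbb)
  have hinterp (d : Fin k) : g.eval (x d) = (Lagrange.nodal univ y).eval (x d) *
      ∑ b, ((derivative (Lagrange.nodal univ y)).eval (y b))⁻¹ * (x d - y b)⁻¹ * g.eval (y b) := by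
    conv_lhs => rw [Lagrange.eq_interpolate hinj hdeg]
    rw [Lagrange.eval_interpolate_not_at_node _ fun b _ => hxy d b]
    simp only [Lagrange.nodalWeight_eq_eval_derivative_nodal (mem_univ _)]
  have hga : g.eval (x a) ≠ 0 := by
    rw [hg, eval_prod]
    refine prod_ne_zero_iff.2 fun d hd => ?_
    simpa [sub_eq_zero] using fun h => (mem_erase.1 (mem_erase.1 hd).2).1 (hx h).symm
  have hgc : g.eval (x c) ≠ 0 := by
    rw [hg, eval_prod]
    refine prod_ne_zero_iff.2 fun d hd => ?_
    simpa [sub_eq_zero] using fun h => (mem_erase.1 hd).1 (hx h).symm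
  have hxac : x a - x c ≠ 0 := sub_ne_zero.2 (hx.ne hac)
  have hna : k * (Lagrange.nodal univ y).eval (x a) = (x a - x c) * g.eval (x a) := by
    have := congrArg (eval (x a)) hy
    rw [hfac] at this
    simpa [Lagrange.nodal, eq_comm] using this
  have hnc : k * (Lagrange.nodal univ y).eval (x c) = (x c - x a) * g.eval (x c) := by
    have := congrArg (eval (x c)) hy
    rw [hfac] at this
    simpa [Lagrange.nodal, eq_comm] using this
  have hterm (b) : 1 / (x a - y b) ^ 2 * (1 / (x c - y b) ^ 2) / ∑ d, 1 / (x d - y b) ^ 2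
      = 1 / (k * (x a - x c)) *
        (((derivative (Lagrange.nodal univ y)).eval (y b))⁻¹ * (x a - y b)⁻¹ * g.eval (y b)
        - ((derivative (Lagrange.nodal univ y)).eval (y b))⁻¹ * (x c - y b)⁻¹ * g.eval (y b)) := by
    have h1 := hsecond b
    have h2 : ∏ d, (y b - x d) = (y b - x a) * ((y b - x c) * g.eval (y b)) := by
      simpa [eval_prod] using congrArg (eval (y b)) hfac
    rw [h2] at h1
    have h3 := hder b
    have h4 := (hW b).ne'
    have h5 := sub_ne_zero.2 (hxy a b)
    have h6 := sub_ne_zero.2 (hxy c b)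
    generalize ∑ d, 1 / (x d - y b) ^ 2 = W at *
    generalize eval (y b) (derivative (Lagrange.nodal univ y)) = D at *
    field_simp
    linear_combination (x a - x c) * h1
  have hsum {d e : Fin k} (hg0 : g.eval (x d) ≠ 0)
      (hn : k * (Lagrange.nodal univ y).eval (x d) = (x d - x e) * g.eval (x d))
      (hde : x d - x e ≠ 0) :
      ∑ b, ((derivative (Lagrange.nodal univ y)).eval (y b))⁻¹ * (x d - y b)⁻¹ * g.eval (y b)
        = k / (x d - x e) := by
    have h := hinterp d
    generalize ∑ b, ((derivative (Lagrange.nodal univ y)).eval (y b))⁻¹ * (x d - y b)⁻¹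
      * g.eval (y b) = S at *
    rw [eq_div_iff hde]
    apply mul_right_cancel₀ hg0
    linear_combination (-S) * hn - k * h
  simp only [hterm]
  rw [← mul_sum, sum_sub_distrib, hsum hga hna hxac,
    hsum hgc hnc (sub_ne_zero.2 (hx.ne hac.symm)), ← neg_sub (x a) (x c)]
  field_simp
  norm_num

/-- Gaussian heat-kernel identity on interlacing roots: if `x_1,...,x_k` are the distinct
roots of a monic degree-`k` polynomial `f` and `y_1,...,y_{k-1}` the roots of `f'`, then
for some `Z > 0` independent of `ζ`,
`∫ exp(-∑_{a,b} (ζ_a-ξ_b)²/(x_a-y_b)²) dξ = Z exp(-2 ∑_{a<b} (ζ_a-ζ_b)²/(x_a-x_b)²)`. -/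
theorem gaussian_interlacing_integral (k : ℕ) (x : Fin k → ℝ) (hx : Function.Injective x)
    (y : Fin (k - 1) → ℝ)
    (hy : Polynomial.derivative (∏ a, (Polynomial.X - Polynomial.C (x a)))
        = Polynomial.C (k : ℝ) * ∏ b, (Polynomial.X - Polynomial.C (y b)))
    (hxy : ∀ a b, x a ≠ y b) :
    ∃ Z : ℝ, 0 < Z ∧ ∀ ζ : Fin k → ℝ,
      (∫ ξ : Fin (k - 1) → ℝ,
          Real.exp (-(∑ a, ∑ b, (ζ a - ξ b) ^ 2 / (x a - y b) ^ 2)))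
        = Z * Real.exp (-(2 * ∑ a, ∑ b ∈ Finset.univ.filter (fun b => a < b),
            (ζ a - ζ b) ^ 2 / (x a - x b) ^ 2)) := by
  have hW (b : Fin (k - 1)) : 0 < ∑ a, 1 / (x a - y b) ^ 2 :=
    sum_pos (fun a _ => by have := sub_ne_zero.2 (hxy a b); positivity)
      ⟨⟨b, by omega⟩, mem_univ _⟩
  refine ⟨∏ b, √(Real.pi / ∑ a, 1 / (x a - y b) ^ 2),
    prod_pos fun b _ => Real.sqrt_pos.2 (div_pos Real.pi_pos (hW b)), fun ζ => ?_⟩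
  have hsplit (ξ : Fin (k - 1) → ℝ) :
      Real.exp (-(∑ a, ∑ b, (ζ a - ξ b) ^ 2 / (x a - y b) ^ 2))
        = ∏ b, Real.exp (-∑ a, 1 / (x a - y b) ^ 2 * (ζ a - ξ b) ^ 2) := by
    rw [← Real.exp_sum, sum_comm, sum_neg_distrib]
    simp only [one_div_mul_eq_div]
  simp only [hsplit]
  rw [integral_fintype_prod_volume_eq_prod
    (fun b t => Real.exp (-∑ a, 1 / (x a - y b) ^ 2 * (ζ a - t) ^ 2))]
  simp only [integral_exp_neg_weighted_sum_sq univ _ ζ (hW _).ne']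
  rw [prod_mul_distrib, ← Real.exp_sum, sum_neg_distrib,
    sum_sum_filter_lt_of_symm (fun a c => (ζ a - ζ c) ^ 2 / (x a - x c) ^ 2)
      (fun a c => by rw [sub_sq_comm (ζ a), sub_sq_comm (x a)]) (fun a => by simp),
    sum_comm]
  congr 3
  refine sum_congr rfl fun a _ => ?_
  rw [sum_comm]
  refine sum_congr rfl fun c _ => ?_
  rcases eq_or_ne a c with rfl | hac
  · simp
  rw [← sum_mul]
  have h := sum_inv_sq_mul_inv_sq_div_critical_points hx hy hxy hac
  have h2 : ∑ b, 1 / (x a - y b) ^ 2 * (1 / (x c - y b) ^ 2) / (2 * ∑ d, 1 / (x d - y b) ^ 2)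
      = 1 / (x a - x c) ^ 2 := by
    rw [sum_congr rfl fun b _ => by rw [mul_comm (2 : ℝ), ← div_div], ← sum_div, h]
    ring
  rw [h2, one_div_mul_eq_div]
end

section
/- The Vandermonde-ratio expectation formula for corners at β = 2 case of interlacing support: for the density (as a function of x_1^{k-1},...,x_{k-1}^{k-1} on the interlacing domain x_1^k < x_1^{k-1} < x_2^k < ... < x_{k-1}^{k-1} < x_k^k) proportional to ∏_{i<j}(x_j^{k-1} − x_i^{k-1}) · ∏_{i,j}|x_i^k − x_j^{k-1}|^{β/2 − 1} · ∏_{i<j}(x_j^k − x_i^k)^{1−β}, the total integral equals Γ(β/2)^k / Γ(kβ/2). -/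
open Finset MeasureTheory Real

/-- The interlacing domain `a 0 < t 0 < a 1 < t 1 < ... < t (n-1) < a n`. -/
def interlacingDomain (n : ℕ) (a : Fin (n + 1) → ℝ) : Set (Fin n → ℝ) :=
  {t | ∀ i : Fin n, a i.castSucc < t i ∧ t i < a i.succ}

/-- The Vandermonde product `∏_{i<j} (x_j - x_i)`. -/
noncomputable def vandermondeProd {m : ℕ} (x : Fin m → ℝ) : ℝ :=
  ∏ i, ∏ j ∈ Finset.Ioi i, (x j - x i)

lemma vandermondeProd_pos {m : ℕ} {x : Fin m → ℝ} (hx : StrictMono x) : 0 < vandermondeProd x :=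
  Finset.prod_pos fun _ _ => Finset.prod_pos fun _ hj => sub_pos.2 (hx (Finset.mem_Ioi.1 hj))

lemma prod_prod_erase_abs_sub {m : ℕ} (x : Fin m → ℝ) :
    ∏ i, ∏ k ∈ Finset.univ.erase i, |x i - x k| = vandermondeProd x ^ 2 := by
  have h := Finset.prod_prod_Ioi_mul_eq_prod_prod_off_diag (fun i j => |x j - x i|)
  have h' : ∀ i : Fin m, Finset.univ.erase i = {i}ᶜ := fun i => by ext; simp
  simp_rw [h', ← h, abs_sub_comm (x _) (x _), Finset.prod_mul_distrib, vandermondeProd,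
    ← sq_abs (∏ i, _), Finset.abs_prod, sq]
  congr 1 <;>
    exact Finset.prod_congr rfl fun i _ => Finset.prod_congr rfl fun j _ => abs_sub_comm _ _

/-- The matrices of values at two families of nodes differ by the ratio of the Vandermonde
determinants. -/
lemma det_eval_mul_det_vandermonde {R : Type*} [CommRing R] {m : ℕ} (p : Fin m → Polynomial R)
    (hp : ∀ i, (p i).degree < m) (x y : Fin m → R) :
    (Matrix.of fun i j => (p j).eval (x i)).det * (Matrix.vandermonde y).det =
      (Matrix.of fun i j => (p j).eval (y i)).det * (Matrix.vandermonde x).det := by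
  have key : ∀ z : Fin m → R, (Matrix.of fun i j => (p j).eval (z i)) =
      Matrix.vandermonde z * Matrix.of fun k j : Fin m => (p j).coeff k := by
    intro z
    ext i j
    rw [Matrix.mul_apply, Matrix.of_apply, Polynomial.eval_eq_sum_degreeLTEquiv
      (Polynomial.mem_degreeLT.2 (hp j))]
    simp [Matrix.vandermonde_apply, mul_comm, Polynomial.degreeLTEquiv]
  rw [key x, key y, Matrix.det_mul, Matrix.det_mul]
  ring

/-- The residue at `a j` of `x₀ ∏ᵢ (z - xᵢ₊₁) / ∏ₖ (z - a k)`. -/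
noncomputable def residue {n : ℕ} (a x : Fin (n + 1) → ℝ) (j : Fin (n + 1)) : ℝ :=
  x 0 * (∏ i : Fin n, (a j - x i.succ)) / ∏ k ∈ Finset.univ.erase j, (a j - a k)

/-- The Jacobian matrix of `residue a`. -/
noncomputable def residueJacobian {n : ℕ} (a x : Fin (n + 1) → ℝ) :
    Matrix (Fin (n + 1)) (Fin (n + 1)) ℝ :=
  Matrix.of fun j => Fin.cons
    ((∏ i : Fin n, (a j - x i.succ)) / ∏ k ∈ Finset.univ.erase j, (a j - a k))
    fun i => -(x 0 * (∏ l ∈ Finset.univ.erase i, (a j - x l.succ)) /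
      ∏ k ∈ Finset.univ.erase j, (a j - a k))

lemma hasFDerivAt_residue {n : ℕ} (a x : Fin (n + 1) → ℝ) :
    HasFDerivAt (residue a) (Matrix.toLin' (residueJacobian a x)).toContinuousLinearMap x := by
  rw [hasFDerivAt_pi']
  intro j
  have h0 : ∀ k : Fin (n + 1), HasFDerivAt (fun y : Fin (n + 1) → ℝ => y k)
      (ContinuousLinearMap.proj (R := ℝ) (φ := fun _ : Fin (n + 1) => ℝ) k) x :=
    fun k => hasFDerivAt_apply k x
  have h1 := ((h0 0).mul (HasFDerivAt.finsetProd (u := Finset.univ) (fun (i : Fin n) _ =>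
    (h0 i.succ).const_sub (a j)))).mul_const (∏ k ∈ Finset.univ.erase j, (a j - a k))⁻¹
  simp only [residue, div_eq_mul_inv]
  refine h1.congr_fderiv ?_
  ext v
  simp [residueJacobian, Matrix.mulVec, dotProduct, Fin.sum_univ_succ, Finset.mul_sum,
    div_eq_mul_inv]
  rw [add_comm]
  congr 1
  · ring
  · exact congrArg _ (Finset.sum_congr rfl fun i _ => by ring)

lemma strictMono_of_mem_interlacingDomain {n : ℕ} {a : Fin (n + 1) → ℝ} (ha : StrictMono a)
    {t : Fin n → ℝ} (ht : t ∈ interlacingDomain n a) : StrictMono t := fun i j hij =>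
  (ht i).2.trans_le ((ha.monotone (Fin.succ_le_castSucc_iff.2 hij)).trans (ht j).1.le)

lemma abs_det_residueJacobian {n : ℕ} {a x : Fin (n + 1) → ℝ} (ha : StrictMono a)
    (hx : 0 < x 0) (ht : Fin.tail x ∈ interlacingDomain n a) :
    |(residueJacobian a x).det| =
      x 0 ^ n * vandermondeProd (Fin.tail x) / vandermondeProd a := by
  set t := Fin.tail x with ht_def
  have hV := vandermondeProd_pos ha
  have hVt := vandermondeProd_pos (strictMono_of_mem_interlacingDomain ha ht)
  let p : Fin (n + 1) → Polynomial ℝ := Fin.cons (∏ i, (Polynomial.X - Polynomial.C (t i)))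
    fun i => -(Polynomial.C (x 0) * ∏ l ∈ Finset.univ.erase i, (Polynomial.X - Polynomial.C (t l)))
  have hp : ∀ i, (p i).degree < ((n + 1 : ℕ) : WithBot ℕ) := by
    intro i
    refine Fin.cases ?_ (fun i => ?_) i
    · simp only [p, Fin.cons_zero, Polynomial.degree_prod, Polynomial.degree_X_sub_C]
      simp
      exact_mod_cast Nat.lt_succ_self n
    · simp only [p, Fin.cons_succ, Polynomial.degree_neg, Polynomial.degree_C_mul hx.ne',
        Polynomial.degree_prod, Polynomial.degree_X_sub_C]
      simp
      exact_mod_cast (by omega : n - 1 < n + 1)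
  let y : Fin (n + 1) → ℝ := Fin.cons (a 0) t
  have ha0 : ∀ i, 0 < t i - a 0 := fun i =>
    sub_pos.2 ((ha.monotone (Fin.zero_le _)).trans_lt (ht i).1)
  have hVy : (Matrix.vandermonde y).det = (∏ i, (t i - a 0)) * vandermondeProd t := by
    rw [Matrix.det_vandermonde]
    simp [Fin.prod_univ_succ, y, Fin.prod_Ioi_succ, vandermondeProd]
  have hMy : |(Matrix.of fun i j => (p j).eval (y i)).det| =
      (∏ i, (t i - a 0)) * (x 0 ^ n * vandermondeProd t ^ 2) := by
    rw [Matrix.det_of_isUpperTriangular, Finset.abs_prod, Fin.prod_univ_succ]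
    · congr 1
      · simp only [Matrix.of_apply, p, y, Fin.cons_zero, Polynomial.eval_prod, Finset.abs_prod]
        simp [abs_sub_comm (a 0), abs_of_pos (ha0 _)]
      · simp [p, y, Polynomial.eval_prod, abs_mul, Finset.abs_prod, Finset.prod_mul_distrib,
          prod_prod_erase_abs_sub, abs_of_pos hx]
    · intro i j hij
      induction i using Fin.cases with
      | zero => simp at hij
      | succ i =>
        induction j using Fin.cases with
        | zero => simp [p, y, Polynomial.eval_prod, Finset.prod_eq_zero_iff, sub_eq_zero]
        | succ j =>
          have : i ≠ j := by rintro rfl; simp at hij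
          simp [p, y, Polynomial.eval_prod, Finset.prod_eq_zero_iff, sub_eq_zero]
          exact Or.inr ⟨i, this, rfl⟩
  have hJ : residueJacobian a x =
      Matrix.diagonal (fun j => (∏ k ∈ Finset.univ.erase j, (a j - a k))⁻¹) *
        Matrix.of fun i j => (p j).eval (a i) := by
    ext j k
    rw [Matrix.diagonal_mul]
    refine Fin.cases ?_ (fun i => ?_) k
    · simp [residueJacobian, p, Polynomial.eval_prod, ht_def, Fin.tail, div_eq_inv_mul]
    · simp [residueJacobian, p, Polynomial.eval_prod, ht_def, Fin.tail, div_eq_inv_mul]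
  have key := congrArg abs (det_eval_mul_det_vandermonde p hp a y)
  have hVa : (Matrix.vandermonde a).det = vandermondeProd a := Matrix.det_vandermonde a
  have hP : 0 < ∏ i, (t i - a 0) := Finset.prod_pos fun i _ => ha0 i
  rw [abs_mul, abs_mul, hMy, hVy, hVa, abs_of_pos hV, abs_of_pos (mul_pos hP hVt)] at key
  rw [hJ, Matrix.det_mul, Matrix.det_diagonal, abs_mul, Finset.abs_prod]
  simp_rw [abs_inv, Finset.abs_prod]
  rw [Finset.prod_inv_distrib, prod_prod_erase_abs_sub]
  have : |(Matrix.of fun i j => (p j).eval (a i)).det| =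
      x 0 ^ n * vandermondeProd t * vandermondeProd a := by
    refine mul_right_cancel₀ (mul_pos hP hVt).ne' (key.trans ?_)
    ring
  rw [this]
  field_simp

lemma prod_erase_eq_prod_succAbove {M : Type*} [CommMonoid M] {n : ℕ} (j : Fin (n + 1))
    (f : Fin (n + 1) → M) : ∏ k ∈ Finset.univ.erase j, f k = ∏ i, f (j.succAbove i) := by
  have h : Finset.univ.erase j = ({j}ᶜ : Finset (Fin (n + 1))) := by ext; simp
  rw [h, ← Fin.image_succAbove_univ, Finset.prod_image Fin.succAbove_right_injective.injOn]

lemma prod_erase_sub_ne_zero {n : ℕ} {a : Fin (n + 1) → ℝ} (ha : StrictMono a) (j : Fin (n + 1)) :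
    ∏ k ∈ Finset.univ.erase j, (a j - a k) ≠ 0 :=
  Finset.prod_ne_zero_iff.2 fun _ hk =>
    sub_ne_zero.2 (ha.injective.ne (Finset.ne_of_mem_erase hk).symm)

/-- The half-cylinder of points whose zeroth coordinate is positive and whose other coordinates
interlace with `a`. -/
def interlacingCylinder {n : ℕ} (a : Fin (n + 1) → ℝ) : Set (Fin (n + 1) → ℝ) :=
  {x | 0 < x 0 ∧ Fin.tail x ∈ interlacingDomain n a}

lemma residue_pos {n : ℕ} {a x : Fin (n + 1) → ℝ} (ha : StrictMono a)
    (hx : x ∈ interlacingCylinder a) (j : Fin (n + 1)) : 0 < residue a x j := by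
  rw [residue, prod_erase_eq_prod_succAbove, mul_div_assoc, ← Finset.prod_div_distrib]
  refine mul_pos hx.1 (Finset.prod_pos fun i _ => ?_)
  have hi : a i.castSucc < x i.succ ∧ x i.succ < a i.succ := hx.2 i
  rcases lt_or_ge i.castSucc j with h | h
  · rw [Fin.succAbove_of_castSucc_lt _ _ h]
    exact div_pos (sub_pos.2 (hi.2.trans_le (ha.monotone (Fin.castSucc_lt_iff_succ_le.1 h))))
      (sub_pos.2 (ha h))
  · rw [Fin.succAbove_of_le_castSucc _ _ h]
    exact div_pos_of_neg_of_neg (sub_neg.2 ((ha.monotone h).trans_lt hi.1))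
      (sub_neg.2 (ha (h.trans_lt i.castSucc_lt_succ)))

/-- The polynomial `x₀ ∏ᵢ (z - xᵢ₊₁)`. -/
noncomputable def rootPoly {n : ℕ} (x : Fin (n + 1) → ℝ) : Polynomial ℝ :=
  Polynomial.C (x 0) * ∏ i : Fin n, (Polynomial.X - Polynomial.C (x i.succ))

lemma rootPoly_eval {n : ℕ} (x : Fin (n + 1) → ℝ) (z : ℝ) :
    (rootPoly x).eval z = x 0 * ∏ i : Fin n, (z - x i.succ) := by
  simp [rootPoly, Polynomial.eval_prod]

lemma rootPoly_degree_lt {n : ℕ} (x : Fin (n + 1) → ℝ) :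
    (rootPoly x).degree < ((n + 1 : ℕ) : WithBot ℕ) := by
  rw [rootPoly, Polynomial.C_mul']
  refine (Polynomial.degree_smul_le _ _).trans_lt ?_
  simp only [Polynomial.degree_prod, Polynomial.degree_X_sub_C]
  simp
  exact_mod_cast Nat.lt_succ_self n

lemma rootPoly_coeff {n : ℕ} (x : Fin (n + 1) → ℝ) : (rootPoly x).coeff n = x 0 := by
  have h : (∏ i : Fin n, (Polynomial.X - Polynomial.C (x i.succ))).coeff n = 1 := by
    have := Polynomial.monic_prod_X_sub_C (fun i : Fin n => x i.succ) Finset.univ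
    rw [← this.coeff_natDegree]
    simp
  rw [rootPoly, Polynomial.coeff_C_mul, h, mul_one]

lemma sum_residue {n : ℕ} {a : Fin (n + 1) → ℝ} (ha : StrictMono a) (x : Fin (n + 1) → ℝ) :
    ∑ j, residue a x j = x 0 := by
  have h := Lagrange.coeff_eq_sum (s := Finset.univ) (v := a) ha.injective.injOn
    (P := rootPoly x) (by simpa using rootPoly_degree_lt x)
  simpa [rootPoly_coeff, rootPoly_eval, residue] using h.symm

lemma rootPoly_eval_node {n : ℕ} {a : Fin (n + 1) → ℝ} (ha : StrictMono a)
    (x : Fin (n + 1) → ℝ) (j : Fin (n + 1)) :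
    (rootPoly x).eval (a j) = residue a x j * ∏ k ∈ Finset.univ.erase j, (a j - a k) := by
  rw [rootPoly_eval, residue, div_mul_cancel₀ _ (prod_erase_sub_ne_zero ha j)]

lemma residue_injOn {n : ℕ} {a : Fin (n + 1) → ℝ} (ha : StrictMono a) :
    Set.InjOn (residue a) (interlacingCylinder a) := by
  intro x hx y hy hxy
  have hp : rootPoly x = rootPoly y :=
    Polynomial.eq_of_degrees_lt_of_eval_index_eq Finset.univ (v := a) ha.injective.injOn
      (by simpa using rootPoly_degree_lt x) (by simpa using rootPoly_degree_lt y)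
      fun j _ => by rw [rootPoly_eval_node ha, rootPoly_eval_node ha, hxy]
  funext k
  refine Fin.cases ?_ (fun i => ?_) k
  · rw [← rootPoly_coeff x, hp, rootPoly_coeff]
  · have h : (rootPoly y).eval (x i.succ) = 0 := by
      rw [← hp, rootPoly_eval, Finset.prod_eq_zero (Finset.mem_univ i) (sub_self _), mul_zero]
    rw [rootPoly_eval, mul_eq_zero, or_iff_right hy.1.ne', Finset.prod_eq_zero_iff] at h
    obtain ⟨l, -, hl⟩ := h
    rw [sub_eq_zero] at hl
    have hi : a i.castSucc < x i.succ ∧ x i.succ < a i.succ := hx.2 i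
    have hy' : a l.castSucc < y l.succ ∧ y l.succ < a l.succ := hy.2 l
    have h1 := ha.lt_iff_lt.1 (hi.1.trans (hl ▸ hy'.2))
    have h2 := ha.lt_iff_lt.1 (hy'.1.trans (hl ▸ hi.2))
    have : i = l := le_antisymm (Fin.castSucc_lt_succ_iff.1 h1) (Fin.castSucc_lt_succ_iff.1 h2)
    rw [hl, this]

lemma prod_erase_sub_mul_neg {n : ℕ} {a : Fin (n + 1) → ℝ} (ha : StrictMono a) (i : Fin n) :
    (∏ k ∈ Finset.univ.erase i.castSucc, (a i.castSucc - a k)) *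
      ∏ k ∈ Finset.univ.erase i.succ, (a i.succ - a k) < 0 := by
  rw [prod_erase_eq_prod_succAbove, prod_erase_eq_prod_succAbove, ← Finset.prod_mul_distrib,
    ← Finset.mul_prod_erase _ _ (Finset.mem_univ i)]
  refine mul_neg_of_neg_of_pos ?_ (Finset.prod_pos fun k hk => ?_)
  · have := ha i.castSucc_lt_succ
    rw [Fin.succAbove_castSucc_self, Fin.succAbove_succ_self]
    exact mul_neg_of_neg_of_pos (sub_neg.2 this) (sub_pos.2 this)
  · rcases lt_or_gt_of_ne (Finset.ne_of_mem_erase hk) with h | h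
    · have h1 : k.castSucc < i.castSucc := h
      have h2 := h1.trans i.castSucc_lt_succ
      rw [Fin.succAbove_of_castSucc_lt _ _ h1, Fin.succAbove_of_castSucc_lt _ _ h2]
      exact mul_pos (sub_pos.2 (ha h1)) (sub_pos.2 (ha h2))
    · have h1 : i.succ < k.succ := Fin.succ_lt_succ_iff.2 h
      have h2 := i.castSucc_lt_succ.trans h1
      rw [Fin.succAbove_of_lt_succ _ _ h1, Fin.succAbove_of_lt_succ _ _ h2]
      exact mul_pos_of_neg_of_neg (sub_neg.2 (ha h2)) (sub_neg.2 (ha h1))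

lemma exists_root_of_mul_neg {f : ℝ → ℝ} (hf : Continuous f) {u v : ℝ} (huv : u < v)
    (h : f u * f v < 0) : ∃ z, u < z ∧ z < v ∧ f z = 0 := by
  rcases mul_neg_iff.1 h with ⟨h1, h2⟩ | ⟨h1, h2⟩
  · obtain ⟨z, hz, hz0⟩ := intermediate_value_Ioo' huv.le hf.continuousOn ⟨h2, h1⟩
    exact ⟨z, hz.1, hz.2, hz0⟩
  · obtain ⟨z, hz, hz0⟩ := intermediate_value_Ioo huv.le hf.continuousOn ⟨h1, h2⟩
    exact ⟨z, hz.1, hz.2, hz0⟩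

lemma image_residue {n : ℕ} {a : Fin (n + 1) → ℝ} (ha : StrictMono a) :
    residue a '' interlacingCylinder a = Set.univ.pi fun _ => Set.Ioi 0 := by
  refine Set.Subset.antisymm (Set.image_subset_iff.2 fun x hx j _ => residue_pos ha hx j) ?_
  intro w hw
  have hw' : ∀ j, 0 < w j := fun j => hw j (Set.mem_univ j)
  set R := Lagrange.interpolate Finset.univ a
    fun j => w j * ∏ k ∈ Finset.univ.erase j, (a j - a k) with hR
  have hRdeg : R.degree < ((n + 1 : ℕ) : WithBot ℕ) := by
    have h := Lagrange.degree_interpolate_lt (s := Finset.univ) (v := a)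
      (fun j => w j * ∏ k ∈ Finset.univ.erase j, (a j - a k)) ha.injective.injOn
    rwa [Finset.card_univ, Fintype.card_fin] at h
  have hRa : ∀ j, R.eval (a j) = w j * ∏ k ∈ Finset.univ.erase j, (a j - a k) := fun j =>
    Lagrange.eval_interpolate_at_node _ ha.injective.injOn (Finset.mem_univ j)
  have hroot : ∀ i : Fin n, ∃ z, a i.castSucc < z ∧ z < a i.succ ∧ R.eval z = 0 := fun i => by
    refine exists_root_of_mul_neg R.continuous (ha i.castSucc_lt_succ) ?_
    rw [hRa, hRa, mul_mul_mul_comm]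
    exact mul_neg_of_pos_of_neg (mul_pos (hw' _) (hw' _)) (prod_erase_sub_mul_neg ha i)
  choose t ht1 ht2 ht3 using hroot
  have ht : t ∈ interlacingDomain n a := fun i => ⟨ht1 i, ht2 i⟩
  have hlast : ∀ i, 0 < a (Fin.last n) - t i := fun i =>
    sub_pos.2 ((ht2 i).trans_le (ha.monotone (Fin.le_last _)))
  have hP : 0 < ∏ i, (a (Fin.last n) - t i) := Finset.prod_pos fun i _ => hlast i
  set s := R.eval (a (Fin.last n)) / ∏ i, (a (Fin.last n) - t i) with hs
  have hs0 : 0 < s := by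
    refine div_pos ?_ hP
    rw [hRa]
    refine mul_pos (hw' _) (Finset.prod_pos fun k hk => sub_pos.2 (ha ?_))
    exact (Fin.le_last k).lt_of_ne (Finset.ne_of_mem_erase hk)
  refine ⟨Fin.cons s t, ⟨by simpa using hs0, by simpa using ht⟩, ?_⟩
  have hinj : Function.Injective (Fin.snoc t (a (Fin.last n)) : Fin (n + 1) → ℝ) :=
    Fin.snoc_injective_iff.2 ⟨(strictMono_of_mem_interlacingDomain ha ht).injective, by
      rintro ⟨i, hi⟩
      exact (hlast i).ne' (sub_eq_zero.2 hi.symm)⟩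
  have hpoly : rootPoly (Fin.cons s t : Fin (n + 1) → ℝ) = R := by
    refine Polynomial.eq_of_degrees_lt_of_eval_index_eq Finset.univ hinj.injOn
      (by simpa using rootPoly_degree_lt _) (by simpa using hRdeg) fun j _ => ?_
    refine Fin.lastCases ?_ (fun i => ?_) j
    · rw [Fin.snoc_last, rootPoly_eval]
      simp [hs, hP.ne']
    · rw [Fin.snoc_castSucc, ht3, rootPoly_eval]
      exact mul_eq_zero_of_right _ (Finset.prod_eq_zero (Finset.mem_univ i) (by simp))
  funext j
  have := rootPoly_eval_node ha (Fin.cons s t : Fin (n + 1) → ℝ) j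
  rw [hpoly, hRa] at this
  exact (mul_right_cancel₀ (prod_erase_sub_ne_zero ha j) this).symm

lemma measurableSet_interlacingDomain (n : ℕ) (a : Fin (n + 1) → ℝ) :
    MeasurableSet (interlacingDomain n a) := by
  have h : interlacingDomain n a = Set.univ.pi fun i => Set.Ioo (a i.castSucc) (a i.succ) := by
    ext t
    simp [interlacingDomain]
  rw [h]
  exact MeasurableSet.univ_pi fun _ => measurableSet_Ioo

lemma interlacingCylinder_eq_preimage {n : ℕ} (a : Fin (n + 1) → ℝ) :
    interlacingCylinder a = MeasurableEquiv.piFinSuccAbove (fun _ => ℝ) 0 ⁻¹'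
      (Set.Ioi 0 ×ˢ interlacingDomain n a) := by
  ext x
  simp [interlacingCylinder, MeasurableEquiv.piFinSuccAbove, Fin.insertNthEquiv, Fin.removeNth_zero]

lemma measurableSet_interlacingCylinder {n : ℕ} (a : Fin (n + 1) → ℝ) :
    MeasurableSet (interlacingCylinder a) := by
  rw [interlacingCylinder_eq_preimage]
  exact (MeasurableEquiv.measurable _)
    (measurableSet_Ioi.prod (measurableSet_interlacingDomain n a))

lemma setIntegral_interlacingCylinder_mul {n : ℕ} (a : Fin (n + 1) → ℝ) (f : ℝ → ℝ)
    (g : (Fin n → ℝ) → ℝ) :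
    ∫ x in interlacingCylinder a, f (x 0) * g (Fin.tail x) =
      (∫ s in Set.Ioi 0, f s) * ∫ t in interlacingDomain n a, g t := by
  rw [← setIntegral_prod_mul, interlacingCylinder_eq_preimage, ← Measure.volume_eq_prod,
    ← (volume_preserving_piFinSuccAbove (fun _ : Fin (n + 1) => ℝ) 0).setIntegral_preimage_emb
      (MeasurableEquiv.measurableEmbedding _)]
  rfl

lemma setIntegral_pi_Ioi_prod_gamma (n : ℕ) {α : ℝ} (hα : 0 < α) :
    ∫ w in Set.univ.pi fun _ : Fin n => Set.Ioi (0 : ℝ), ∏ j, (exp (-w j) * w j ^ (α - 1)) =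
      Gamma α ^ n := by
  rw [volume_pi, Measure.restrict_pi_pi,
    integral_fintype_prod_eq_pow fun s : ℝ => exp (-s) * s ^ (α - 1), Gamma_eq_integral hα,
    Fintype.card_fin]

/-- The integrand of the Gamma integral, in the coordinates given by `residue`. -/
lemma abs_det_mul_prod_gamma_residue {n : ℕ} {a x : Fin (n + 1) → ℝ} (ha : StrictMono a)
    (hx : x ∈ interlacingCylinder a) (α : ℝ) :
    |(residueJacobian a x).det| * ∏ j, (exp (-residue a x j) * residue a x j ^ (α - 1)) =
      (exp (-x 0) * x 0 ^ ((n + 1) * α - 1)) *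
        (vandermondeProd (Fin.tail x) * (∏ i, ∏ j, |Fin.tail x i - a j| ^ (α - 1)) *
          vandermondeProd a ^ (1 - 2 * α)) := by
  have hV := vandermondeProd_pos ha
  have hx0 := hx.1
  have hprod : ∏ j, residue a x j =
      x 0 ^ (n + 1) * (∏ i, ∏ j, |Fin.tail x i - a j|) / vandermondeProd a ^ 2 := by
    rw [← prod_prod_erase_abs_sub, ← abs_of_pos (Finset.prod_pos fun j _ => residue_pos ha hx j)]
    simp_rw [Finset.abs_prod, residue, abs_div, abs_mul, Finset.abs_prod, abs_of_pos hx0,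
      Finset.prod_div_distrib, Finset.prod_mul_distrib]
    rw [Finset.prod_comm (s := Finset.univ) (t := Finset.univ)]
    simp [abs_sub_comm, Fin.tail]
  have hT : 0 ≤ ∏ i, ∏ j, |Fin.tail x i - a j| :=
    Finset.prod_nonneg fun _ _ => Finset.prod_nonneg fun _ _ => abs_nonneg _
  rw [Finset.prod_mul_distrib, ← exp_sum, Finset.sum_neg_distrib, sum_residue ha,
    finsetProd_rpow _ _ fun j _ => (residue_pos ha hx j).le, hprod,
    abs_det_residueJacobian ha hx0 hx.2,
    div_rpow (mul_nonneg (pow_nonneg hx0.le _) hT) (sq_nonneg _),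
    mul_rpow (pow_nonneg hx0.le _) hT]
  simp_rw [finsetProd_rpow _ _ fun j _ => abs_nonneg _]
  rw [finsetProd_rpow _ _ fun i _ => Finset.prod_nonneg fun _ _ => abs_nonneg _,
    ← rpow_natCast, ← rpow_natCast, ← rpow_natCast, ← rpow_mul hx0.le, ← rpow_mul hV.le]
  have h1 : x 0 ^ ((n + 1) * α - 1) = x 0 ^ (n : ℝ) * x 0 ^ (((n + 1 : ℕ) : ℝ) * (α - 1)) := by
    rw [← rpow_add hx0]
    push_cast
    ring_nf
  have h2 : vandermondeProd a ^ (1 - 2 * α) =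
      (vandermondeProd a)⁻¹ * (vandermondeProd a ^ (((2 : ℕ) : ℝ) * (α - 1)))⁻¹ := by
    rw [← rpow_neg_one, ← rpow_neg hV.le, ← rpow_add hV]
    push_cast
    ring_nf
  rw [h1, h2]
  ring

lemma setIntegral_interlacingDomain {n : ℕ} {a : Fin (n + 1) → ℝ} (ha : StrictMono a) {α : ℝ}
    (hα : 0 < α) :
    ∫ t in interlacingDomain n a, vandermondeProd t * (∏ i, ∏ j, |t i - a j| ^ (α - 1)) *
        vandermondeProd a ^ (1 - 2 * α) =
      Gamma α ^ (n + 1) / Gamma ((n + 1) * α) := by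
  have hα' : 0 < ((n : ℝ) + 1) * α := by positivity
  rw [eq_div_iff (Gamma_pos_of_pos hα').ne', mul_comm, Gamma_eq_integral hα',
    ← setIntegral_interlacingCylinder_mul, ← setIntegral_pi_Ioi_prod_gamma (n + 1) hα,
    ← image_residue ha, integral_image_eq_integral_abs_det_fderiv_smul volume
      (measurableSet_interlacingCylinder a)
      (fun x _ => (hasFDerivAt_residue a x).hasFDerivWithinAt) (residue_injOn ha)]
  refine setIntegral_congr_fun (measurableSet_interlacingCylinder a) fun x hx => ?_
  rw [← abs_det_mul_prod_gamma_residue ha hx α, smul_eq_mul,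
    LinearMap.det_toContinuousLinearMap, LinearMap.det_toLin']

/-- Dixon–Anderson integral with `b = ∞` and all `αᵢ = β/2`: the total integral of the
conditional density of the `β`-corners process equals `Γ(β/2)^{n+1} / Γ((n+1)β/2)`;
equivalently `∫_T ∏_{i<j}(t_j-t_i) ∏_{i,j}|t_i-a_j|^{β/2-1} dt
  = [Γ(β/2)^{n+1}/Γ((n+1)β/2)] ∏_{i<j}(a_j-a_i)^{β-1}`. -/
theorem dixon_anderson_corners (n : ℕ) (β : ℝ) (hβ : 0 < β)
    (a : Fin (n + 1) → ℝ) (ha : StrictMono a) :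
    (∫ t in interlacingDomain n a,
        (∏ i : Fin n, ∏ j ∈ Finset.univ.filter (fun j => i < j), (t j - t i)) *
          (∏ i : Fin n, ∏ j : Fin (n + 1), |t i - a j| ^ (β / 2 - 1)) *
          (∏ i : Fin (n + 1), ∏ j ∈ Finset.univ.filter (fun j => i < j),
            (a j - a i) ^ (1 - β)))
      = Real.Gamma (β / 2) ^ (n + 1) / Real.Gamma ((n + 1) * β / 2) := by
  have hV : ∏ i : Fin (n + 1), ∏ j ∈ Finset.univ.filter (fun j => i < j),
      (a j - a i) ^ (1 - β) = vandermondeProd a ^ (1 - 2 * (β / 2)) := by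
    have h0 : ∀ i, ∀ j ∈ Finset.Ioi i, 0 ≤ a j - a i := fun i j hj =>
      sub_nonneg.2 (ha.monotone (Finset.mem_Ioi.1 hj).le)
    simp_rw [Finset.filter_lt_eq_Ioi]
    rw [vandermondeProd, ← finsetProd_rpow _ _ fun i _ => Finset.prod_nonneg (h0 i),
      mul_div_cancel₀ _ two_ne_zero]
    exact Finset.prod_congr rfl fun i _ => finsetProd_rpow _ _ (h0 i) _
  rw [hV, mul_div_assoc, ← setIntegral_interlacingDomain ha (half_pos hβ)]
  simp_rw [Finset.filter_lt_eq_Ioi, vandermondeProd]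
end
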